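/- In the toy instance with cost matrix c = [[0,0,0],[0.3,0,0],[1.2,0.3,0]], the stochastic policy π* given by π*(x_1) = 1, π*(x_2) = 0.7, π*(x_3) = 0 is optimal: u(π*, 0.1) = 0.66 and u(π, 0.1) ≤ 0.66 for every decision policy π : {1,2,3} → [0,1]. -/

import Mathlib

open scoped Classical

/-- The best response of an individual with features `x i` to policy `π` under cost `c`:
the element of `argmax_k (π k - c i k)` with the highest outcome and, among maximizers
with equal outcome, the lowest index.  Since indices are sorted in decreasing order of
outcome, this is the minimal index among the maximizers. -/
noncomputable def bestResponse {m : ℕ} [NeZero m] (c : Fin m → Fin m → ℝ)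
    (π : Fin m → ℝ) (i : Fin m) : Fin m :=
  (Finset.univ.filter (fun k => ∀ l, π l - c i l ≤ π k - c i k)).min' (by
    obtain ⟨k, -, hk⟩ := Finset.exists_max_image Finset.univ (fun k => π k - c i k)
      ⟨i, Finset.mem_univ i⟩
    exact ⟨k, Finset.mem_filter.mpr ⟨Finset.mem_univ k, fun l => hk l (Finset.mem_univ l)⟩⟩)

/-- The utility of a decision policy `π`:  `u(π,γ) = Σ_i P(x_i) · π(x_{br_π(i)}) · (q_{br_π(i)} − γ)`. -/
noncomputable def utility {m : ℕ} [NeZero m] (P q : Fin m → ℝ) (c : Fin m → Fin m → ℝ)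
    (γ : ℝ) (π : Fin m → ℝ) : ℝ :=
  ∑ i, P i * π (bestResponse c π i) * (q (bestResponse c π i) - γ)

/-- A decision policy takes values in `[0,1]`. -/
def IsPolicy {m : ℕ} (π : Fin m → ℝ) : Prop := ∀ i, 0 ≤ π i ∧ π i ≤ 1


/-- The cost matrix of the toy instance: `c = [[0,0,0],[0.3,0,0],[1.2,0.3,0]]`. -/
noncomputable def toyCost : Fin 3 → Fin 3 → ℝ :=
  ![![0, 0, 0], ![0.3, 0, 0], ![1.2, 0.3, 0]]

/-- The utility in the toy instance with `P = (0.1, 0.4, 0.5)`, `q = (1, 0.7, 0.4)`,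
`γ = 0.1` and the cost matrix `toyCost`. -/
noncomputable def toyUtility (π : Fin 3 → ℝ) : ℝ :=
  utility ![0.1, 0.4, 0.5] ![1, 0.7, 0.4] toyCost 0.1 π

theorem le_bestResponse {m : ℕ} [NeZero m] (c : Fin m → Fin m → ℝ) (π : Fin m → ℝ)
    (i l : Fin m) : π l - c i l ≤ π (bestResponse c π i) - c i (bestResponse c π i) :=
  (Finset.mem_filter.mp (Finset.min'_mem (Finset.univ.filter
    (fun k => ∀ l, π l - c i l ≤ π k - c i k)) _)).2 l

theorem bestResponse_le {m : ℕ} [NeZero m] {c : Fin m → Fin m → ℝ} {π : Fin m → ℝ}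
    {i k : Fin m} (h : ∀ l, π l - c i l ≤ π k - c i k) : bestResponse c π i ≤ k :=
  Finset.min'_le _ _ (Finset.mem_filter.mpr ⟨Finset.mem_univ k, h⟩)

theorem toyUtility_optimalPolicy : toyUtility ![1, 0.7, 0] = 0.66 := by
  have h0 : bestResponse toyCost ![1, 0.7, 0] 0 = 0 := by
    refine Fin.le_zero_iff.mp (bestResponse_le fun l => ?_)
    fin_cases l <;> norm_num [toyCost]
  have h1 : bestResponse toyCost ![1, 0.7, 0] 1 = 0 := by
    refine Fin.le_zero_iff.mp (bestResponse_le fun l => ?_)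
    fin_cases l <;> norm_num [toyCost]
  have h2 : bestResponse toyCost ![1, 0.7, 0] 2 = 1 := by
    have h := le_bestResponse toyCost ![1, 0.7, 0] 2 1
    generalize bestResponse toyCost ![1, 0.7, 0] 2 = j at h ⊢
    fin_cases j
    · simp [toyCost] at h
      norm_num at h
    · rfl
    · simp [toyCost] at h
      norm_num at h
  simp only [toyUtility, utility, Fin.sum_univ_three, h0, h1, h2]
  simp
  norm_num

theorem toyUtility_le {π : Fin 3 → ℝ} (hπ : ∀ i, 0 ≤ π i ∧ π i ≤ 1) :
    toyUtility π ≤ 0.66 := by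
  have h1 := le_bestResponse toyCost π 1 0
  have h1' := le_bestResponse toyCost π 1 1
  have h2 := le_bestResponse toyCost π 2 2
  obtain ⟨ha, ha'⟩ := hπ 0
  obtain ⟨hb, hb'⟩ := hπ 1
  obtain ⟨hc, hc'⟩ := hπ 2
  simp only [toyUtility, utility, Fin.sum_univ_three]
  generalize bestResponse toyCost π 0 = i at *
  generalize bestResponse toyCost π 1 = j at *
  generalize bestResponse toyCost π 2 = k at *
  fin_cases i <;> fin_cases j <;> fin_cases k <;>
    simp [toyCost] at h1 h1' h2 ⊢ <;> norm_num at * <;> linarith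

/-- In the toy instance, the stochastic policy `π* = (1, 0.7, 0)` is optimal:
`u(π*, 0.1) = 0.66` and every decision policy has utility at most `0.66`. -/
theorem stmt11 :
    toyUtility ![1, 0.7, 0] = 0.66 ∧
    ∀ π : Fin 3 → ℝ, (∀ i, 0 ≤ π i ∧ π i ≤ 1) → toyUtility π ≤ 0.66 :=
  ⟨toyUtility_optimalPolicy, fun _ => toyUtility_le⟩
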